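/- Let {ρ_i}_{i∈ℤ^d} satisfy hypotheses (H1) and (H2) and let {ρ_Λ}_{Λ∈𝒮} be the constructed family. For finite nonempty V and disjoint finite nonempty W ⊆ ℤ^d∖V, on the set B_{V∪W} = ⋂_{i∈V∪W} B(i,(V∪W)∖{i}) one has ρ_{V∪W} = ρ_V / λ_V(ρ_V ρ_W^{-1}) = ρ_W / λ_W(ρ_W ρ_V^{-1}). -/

import Mathlib

open MeasureTheory ProbabilityTheory
open scoped ENNReal NNReal

namespace GibbsSingleton

/-- Configuration space `E^ι`. -/
abbrev Config (ι E : Type*) := ι → E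

variable {ι E : Type*}

/-- The configuration equal to `σ` on `Λ` and to `ω` off `Λ`. -/
def subst [DecidableEq ι] (Λ : Finset ι) (σ : {x // x ∈ Λ} → E) (ω : Config ι E) :
    Config ι E := fun i => if h : i ∈ Λ then σ ⟨i, h⟩ else ω i

variable [MeasurableSpace E]

/-- The free kernel `λ_Λ` applied to an `ℝ≥0∞`-valued function:
`λ_Λ(h ∣ ω) = ∫ h(σ_Λ ω) λ^Λ(dσ_Λ)`. -/
noncomputable def freeF [DecidableEq ι] (lam : ι → Measure E) (Λ : Finset ι)
    (h : Config ι E → ℝ≥0∞) (ω : Config ι E) : ℝ≥0∞ :=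
  ∫⁻ σ : {x // x ∈ Λ} → E, h (subst Λ σ ω) ∂(Measure.pi fun i : {x // x ∈ Λ} => lam i.1)

/-- The function `ρ_i ρ_j⁻¹`, `ℝ≥0∞`-valued. -/
noncomputable def rat (ρ : ι → Config ι E → ℝ≥0) (i j : ι) (η : Config ι E) : ℝ≥0∞ :=
  (ρ i η : ℝ≥0∞) / (ρ j η : ℝ≥0∞)

/-- The set `b(j,V,ω)` of good configurations at site `j` given `ω` outside `V ∪ {j}`. -/
noncomputable def bSet [DecidableEq ι] (lam : ι → Measure E) (ρ : ι → Config ι E → ℝ≥0)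
    (j : ι) (V : Finset ι) (ω : Config ι E) : Set E :=
  {x | (∀ σ : {y // y ∈ V} → E, 0 < ρ j (subst V σ (Function.update ω j x))) ∧
    ∀ i, i ≠ j →
      0 < (⨅ σ : {y // y ∈ V} → E,
          freeF lam {i} (rat ρ i j) (subst V σ (Function.update ω j x))) ∧
      (⨆ σ : {y // y ∈ V} → E,
          freeF lam {i} (rat ρ i j) (subst V σ (Function.update ω j x))) < ⊤}

/-- The multi-site good set `b(V,W,ω)`. -/
noncomputable def bSetF [DecidableEq ι] (lam : ι → Measure E) (ρ : ι → Config ι E → ℝ≥0)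
    (V W : Finset ι) (ω : Config ι E) : Set ({x // x ∈ V} → E) :=
  {xV | ∀ k : {x // x ∈ V}, xV k ∈ bSet lam ρ k.1 ((V.erase k.1) ∪ W) ω}

/-- The set `B(j,V) = {ω : ω_j ∈ b(j,V,ω)}`. -/
noncomputable def BSet [DecidableEq ι] (lam : ι → Measure E) (ρ : ι → Config ι E → ℝ≥0)
    (j : ι) (V : Finset ι) : Set (Config ι E) :=
  {ω | ω j ∈ bSet lam ρ j V ω}

/-- Hypothesis (H1): every good set `b(j,V,ω)` is nonempty. -/
def H1 [DecidableEq ι] (lam : ι → Measure E) (ρ : ι → Config ι E → ℝ≥0) : Prop :=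
  ∀ (ω : Config ι E) (j : ι) (V : Finset ι), j ∉ V → (bSet lam ρ j V ω).Nonempty

/-- The order-consistency identity appearing in hypothesis (H2), with the convention
`1/∞ = 0` built into `ℝ≥0∞` division. -/
def H2id [DecidableEq ι] (lam : ι → Measure E) (ρ : ι → Config ι E → ℝ≥0)
    (i j : ι) (ω : Config ι E) : Prop :=
  ∀ xi ∈ bSet lam ρ i {j} ω, ∀ xj ∈ bSet lam ρ j {i} ω,
    ((ρ i ω : ℝ≥0∞) * (ρ j (Function.update ω i xi) : ℝ≥0∞)) /
      ((ρ i (Function.update ω i xi) : ℝ≥0∞) *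
        freeF lam {j} (rat ρ j i) (Function.update ω i xi))
    = ((ρ j ω : ℝ≥0∞) * (ρ i (Function.update ω j xj) : ℝ≥0∞)) /
      ((ρ j (Function.update ω j xj) : ℝ≥0∞) *
        freeF lam {i} (rat ρ i j) (Function.update ω j xj))

/-- Hypothesis (H2). -/
def H2 [DecidableEq ι] (lam : ι → Measure E) (ρ : ι → Config ι E → ℝ≥0) : Prop :=
  ∀ i j, i ≠ j → ∀ ω : Config ι E, H2id lam ρ i j ω

/-- `R_Θ^Γ` evaluated using the choice `x_Θ`:
`((ρ_Θ/ρ_Γ) ⬝ λ_Γ(ρ_Γ ρ_Θ⁻¹))(x_Θ ω)`. -/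
noncomputable def Rexpr [DecidableEq ι] (lam : ι → Measure E)
    (ρF : Finset ι → Config ι E → ℝ≥0) (Θ Γ : Finset ι) (x : {y // y ∈ Θ} → E)
    (ω : Config ι E) : ℝ≥0∞ :=
  ((ρF Θ (subst Θ x ω) : ℝ≥0∞) / (ρF Γ (subst Θ x ω) : ℝ≥0∞)) *
    freeF lam Γ (fun η => (ρF Γ η : ℝ≥0∞) / (ρF Θ η : ℝ≥0∞)) (subst Θ x ω)

/-- The family `ρ_Λ` is obtained from the singletons `ρ_i` by the recursive construction
`ρ_{Λ∪{i}} = ρ_Λ / R_Λ^i`, `R_Λ^i(ω) = ((ρ_Λ/ρ_i) ⬝ λ_i(ρ_i ρ_Λ⁻¹))(x_Λ ω)`,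
`x_Λ ∈ b(Λ,{i},ω)` (the value being independent of this choice). -/
def IsRec [DecidableEq ι] (lam : ι → Measure E) (ρ : ι → Config ι E → ℝ≥0)
    (ρF : Finset ι → Config ι E → ℝ≥0) : Prop :=
  (∀ ω, ρF ∅ ω = 1) ∧ (∀ i, ρF {i} = ρ i) ∧ (∀ Λ, Measurable (ρF Λ)) ∧
  ∀ (Λ : Finset ι) (i : ι), i ∉ Λ → ∀ ω : Config ι E,
    (∀ x ∈ bSetF lam ρ Λ {i} ω, ∀ x' ∈ bSetF lam ρ Λ {i} ω,
      Rexpr lam ρF Λ {i} x ω = Rexpr lam ρF Λ {i} x' ω) ∧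
    ∀ x ∈ bSetF lam ρ Λ {i} ω,
      (ρF (insert i Λ) ω : ℝ≥0∞) = (ρF Λ ω : ℝ≥0∞) / Rexpr lam ρF Λ {i} x ω

/-- The sub-σ-algebra `𝓕_U` of events generated by the coordinates in `U`. -/
def cylSigma (E : Type*) [MeasurableSpace E] {ι : Type*} (U : Set ι) :
    MeasurableSpace (Config ι E) :=
  MeasurableSpace.comap (fun ω (i : U) => ω i.1) MeasurableSpace.pi

/-- A specification: a family of probability kernels, measurable w.r.t. the outside
σ-algebra, proper, and consistent. -/
def IsSpecification (γ : Finset ι → Kernel (Config ι E) (Config ι E)) : Prop :=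
  (∀ Λ, IsMarkovKernel (γ Λ)) ∧
  (∀ (Λ : Finset ι) (A : Set (Config ι E)), MeasurableSet A →
    Measurable[cylSigma E ((Λ : Set ι)ᶜ)] fun ω => γ Λ ω A) ∧
  (∀ (Λ : Finset ι) (B : Set (Config ι E)), MeasurableSet[cylSigma E ((Λ : Set ι)ᶜ)] B →
    ∀ ω, γ Λ ω B = B.indicator (fun _ => (1 : ℝ≥0∞)) ω) ∧
  (∀ Λ Δ : Finset ι, Λ ⊆ Δ → (γ Λ).comp (γ Δ) = γ Δ)

/-- The kernel family `γ` is `{ρ_Λ λ_Λ}`. -/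
def MatchesDensity [DecidableEq ι] (lam : ι → Measure E)
    (γ : Finset ι → Kernel (Config ι E) (Config ι E))
    (ρF : Finset ι → Config ι E → ℝ≥0) : Prop :=
  ∀ (Λ : Finset ι) (ω : Config ι E) (A : Set (Config ι E)), MeasurableSet A →
    γ Λ ω A = freeF lam Λ (fun η => (ρF Λ η : ℝ≥0∞) * A.indicator (fun _ => 1) η) ω

end GibbsSingleton

namespace GibbsSingleton

section aux
variable {ι E : Type*} [MeasurableSpace E]

theorem subst_eq [DecidableEq ι] (Λ : Finset ι) (σ : {x // x ∈ Λ} → E) (ω : Config ι E) :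
    subst Λ σ ω = Function.updateFinset ω Λ σ := rfl

theorem freeF_eq [DecidableEq ι] (lam : ι → Measure E) (Λ : Finset ι)
    (h : Config ι E → ℝ≥0∞) (ω : Config ι E) : freeF lam Λ h ω = lmarginal lam Λ h ω := rfl

theorem freeF_single [DecidableEq ι] (lam : ι → Measure E) (i : ι)
    (h : Config ι E → ℝ≥0∞) (ω : Config ι E) :
    freeF lam {i} h ω = ∫⁻ s, h (Function.update ω i s) ∂(lam i) := by
  rw [freeF_eq, lmarginal_singleton]

theorem sf_restrict (μ : Measure E) (g : E → ℝ≥0∞) (hg : Measurable g) (hi : ∫⁻ s, g s ∂μ ≠ ⊤) :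
    SigmaFinite (μ.restrict {s | g s ≠ 0}) := by
  set S := {s | g s ≠ 0}
  have hS : MeasurableSet S := hg (measurableSet_singleton 0).compl
  have hi' : ∫⁻ s, g s ∂(μ.restrict S) ≠ ⊤ :=
    ne_top_of_le_ne_top hi (lintegral_mono' Measure.restrict_le_self le_rfl)
  have h0 : ∀ᵐ s ∂(μ.restrict S), g s ≠ 0 := ae_restrict_mem hS
  have ht : ∀ᵐ s ∂(μ.restrict S), g s ≠ ⊤ := by
    filter_upwards [ae_lt_top hg hi'] with s hs using hs.ne
  rw [← withDensity_inv_same hg h0 ht]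
  haveI : IsFiniteMeasure ((μ.restrict S).withDensity g) := isFiniteMeasure_withDensity hi'
  apply SigmaFinite.withDensity_of_ne_top
  filter_upwards [(withDensity_absolutelyContinuous _ g).ae_le h0] with s hs
  simpa using hs

theorem pi_restrict_sf {κ : Type*} [Fintype κ] (μ : κ → Measure E) (S : κ → Set E)
    (hS : ∀ k, MeasurableSet (S k)) (hsf : ∀ k, SigmaFinite ((μ k).restrict (S k))) :
    (Measure.pi μ).restrict (Set.univ.pi S) = Measure.pi fun k => (μ k).restrict (S k) := by
  symm
  apply Measure.pi_eq
  intro B hB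
  have hm : MeasurableSet (Set.univ.pi fun k => B k ∩ S k) :=
    MeasurableSet.univ_pi fun k => (hB k).inter (hS k)
  rw [Measure.restrict_apply (MeasurableSet.univ_pi hB), ← Set.pi_inter_distrib]
  simp_rw [Measure.restrict_apply (hB _)]
  apply le_antisymm
  · rw [Measure.pi, toMeasure_apply _ _ hm]
    exact OuterMeasure.pi_pi_le _ _
  · have h1 : ∏ k, μ k (B k ∩ S k)
        = Measure.pi (fun k => (μ k).restrict (S k)) (Set.univ.pi fun k => B k ∩ S k) := by
      rw [Measure.pi_pi]
      refine Finset.prod_congr rfl fun k _ => ?_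
      rw [Measure.restrict_apply ((hB k).inter (hS k)), Set.inter_assoc, Set.inter_self]
    rw [h1, Measure.pi_def μ, toMeasure_apply _ _ hm]
    have : (Measure.pi (fun k => (μ k).restrict (S k))).toOuterMeasure
        ≤ OuterMeasure.pi fun k => (μ k).toOuterMeasure := by
      rw [OuterMeasure.le_pi]
      intro s _
      change Measure.pi (fun k => (μ k).restrict (S k)) (Set.univ.pi s) ≤ _
      rw [Measure.pi_pi]
      exact Finset.prod_le_prod' fun k _ => Measure.restrict_apply_le _ _
    exact this _

theorem freeF_restrict [DecidableEq ι] (lam : ι → Measure E) (S : ι → Set E)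
    (hS : ∀ k, MeasurableSet (S k)) (hsf : ∀ k, SigmaFinite ((lam k).restrict (S k)))
    (Λ : Finset ι) (h : Config ι E → ℝ≥0∞) (ω : Config ι E)
    (hh : ∀ σ, h (subst Λ σ ω) ≠ 0 → ∀ k, σ k ∈ S k.1) :
    freeF lam Λ h ω = freeF (fun k => (lam k).restrict (S k)) Λ h ω := by
  unfold freeF
  rw [← pi_restrict_sf (fun k : {x // x ∈ Λ} => lam k.1) (fun k => S k.1) (fun k => hS _)
    (fun k => hsf _)]
  rw [setLIntegral_eq_of_support_subset]
  intro σ hσ k _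
  exact hh σ hσ k

end aux

end GibbsSingleton

namespace GibbsSingleton

section core
variable {ι E : Type*} [MeasurableSpace E] [DecidableEq ι]

/-- `ξ` agrees with `ω` off `T` and on `Λ`. -/
def Zc (T : Finset ι) (ω : Config ι E) (Λ : Finset ι) (ξ : Config ι E) : Prop :=
  (∀ i, i ∉ T → ξ i = ω i) ∧ ∀ k ∈ Λ, ξ k = ω k

/-- The integral `λ_i(ρ_i/ρ_Λ)`. -/
noncomputable def qf (lam : ι → Measure E) (ρ : ι → Config ι E → ℝ≥0)
    (ρF : Finset ι → Config ι E → ℝ≥0) (Λ : Finset ι) (i : ι) (ξ : Config ι E) : ℝ≥0∞ :=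
  ∫⁻ s, (ρ i (Function.update ξ i s) : ℝ≥0∞) / (ρF Λ (Function.update ξ i s) : ℝ≥0∞) ∂(lam i)

/-- Working hypotheses around a good configuration. -/
structure GoodAt (lam : ι → Measure E) (ρ : ι → Config ι E → ℝ≥0)
    (ρF : Finset ι → Config ι E → ℝ≥0) (T : Finset ι) (ω : Config ι E) : Prop where
  pos : ∀ j ∈ T, ∀ η, Zc T ω {j} η → 0 < ρ j η
  bd : ∀ j ∈ T, ∀ i, i ≠ j → ∃ a b : ℝ≥0∞, 0 < a ∧ b < ⊤ ∧ ∀ η, Zc T ω {j} η →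
    a ≤ freeF lam {i} (rat ρ i j) η ∧ freeF lam {i} (rat ρ i j) η ≤ b
  sing : ∀ i, ρF {i} = ρ i
  meas : ∀ Λ, Measurable (ρF Λ)
  rc : ∀ Λ ⊆ T, ∀ i ∈ T, i ∉ Λ → ∀ η, Zc T ω ∅ η →
    (ρF (insert i Λ) η : ℝ≥0∞) = (ρF Λ η : ℝ≥0∞) /
      (((ρF Λ (Λ.piecewise ω η) : ℝ≥0∞) / (ρ i (Λ.piecewise ω η) : ℝ≥0∞)) *
        qf lam ρ ρF Λ i (Λ.piecewise ω η))

variable {lam : ι → Measure E} {ρ : ι → Config ι E → ℝ≥0}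
  {ρF : Finset ι → Config ι E → ℝ≥0} {T : Finset ι} {ω : Config ι E}

theorem Zc.update {Λ : Finset ι} {ξ : Config ι E} (h : Zc T ω Λ ξ) {i : ι} (hi : i ∈ T)
    (hi' : i ∉ Λ) (s : E) : Zc T ω Λ (Function.update ξ i s) := by
  refine ⟨fun k hk => ?_, fun k hk => ?_⟩
  · rw [Function.update_of_ne (by rintro rfl; exact hk hi)]; exact h.1 k hk
  · rw [Function.update_of_ne (by rintro rfl; exact hi' hk)]; exact h.2 k hk

theorem Zc.mono {Λ Λ' : Finset ι} {ξ : Config ι E} (h : Zc T ω Λ ξ) (hs : Λ' ⊆ Λ) :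
    Zc T ω Λ' ξ := ⟨h.1, fun k hk => h.2 k (hs hk)⟩

theorem Zc.pw {Λ : Finset ι} {ξ : Config ι E} (h : Zc T ω ∅ ξ) :
    Zc T ω Λ (Λ.piecewise ω ξ) := by
  refine ⟨fun k hk => ?_, fun k hk => ?_⟩
  · by_cases hk' : k ∈ Λ
    · simp [hk']
    · simp [hk', h.1 k hk]
  · simp [hk]

theorem Zc.pw_eq {Λ : Finset ι} {ξ : Config ι E} (h : Zc T ω Λ ξ) :
    Λ.piecewise ω ξ = ξ := by
  ext k
  by_cases hk' : k ∈ Λ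
  · simp [hk', h.2 k hk']
  · simp [hk']

theorem ennreal_aux1 (p r : ℝ≥0) (q : ℝ≥0∞) (hp : 0 < p) (hr : 0 < r) :
    (p : ℝ≥0∞) / (((p : ℝ≥0∞) / r) * q) = r / q := by
  have hp0 : (p : ℝ≥0∞) ≠ 0 := by exact_mod_cast hp.ne'
  have hr0 : (r : ℝ≥0∞) ≠ 0 := by exact_mod_cast hr.ne'
  have hpt : (p : ℝ≥0∞) ≠ ⊤ := ENNReal.coe_ne_top
  have hrt : (r : ℝ≥0∞) ≠ ⊤ := ENNReal.coe_ne_top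
  have hpr0 : (p : ℝ≥0∞) / r ≠ 0 := (ENNReal.div_pos hp0 hrt).ne'
  have hprt : (p : ℝ≥0∞) / r ≠ ⊤ := ENNReal.div_ne_top hpt hr0
  rw [div_eq_mul_inv, ENNReal.mul_inv (Or.inl hpr0) (Or.inl hprt), ENNReal.inv_div (Or.inl hrt)
    (Or.inl hr0), ← mul_assoc, ENNReal.mul_div_cancel hp0 hpt, div_eq_mul_inv]

theorem GoodAt.ins (G : GoodAt lam ρ ρF T ω) {Λ : Finset ι} (hΛ : Λ ⊆ T)
    (hp : ∀ ξ, Zc T ω Λ ξ → 0 < ρF Λ ξ) {i : ι} (hi : i ∈ T) (hi' : i ∉ Λ) {ξ : Config ι E}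
    (hξ : Zc T ω (insert i Λ) ξ) :
    (ρF (insert i Λ) ξ : ℝ≥0∞) = ρ i ξ / qf lam ρ ρF Λ i ξ := by
  have hξ' : Zc T ω Λ ξ := hξ.mono (Finset.subset_insert _ _)
  rw [G.rc Λ hΛ i hi hi' ξ (hξ.mono (by simp)), hξ'.pw_eq]
  exact ennreal_aux1 _ _ _ (hp _ hξ') (G.pos i hi ξ (hξ.mono (by simp)))

theorem GoodAt.bounds (G : GoodAt lam ρ ρF T ω) (Λ : Finset ι) : Λ.Nonempty → Λ ⊆ T →
    (∀ ξ, Zc T ω Λ ξ → 0 < ρF Λ ξ) ∧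
    ∀ i ∈ T, i ∉ Λ → ∃ a b : ℝ≥0∞, 0 < a ∧ b < ⊤ ∧ ∀ ξ, Zc T ω Λ ξ →
      a ≤ qf lam ρ ρF Λ i ξ ∧ qf lam ρ ρF Λ i ξ ≤ b := by
  induction Λ using Finset.induction_on with
  | empty => intro h; simp at h
  | insert j Λ hj ih =>
    intro _ hT
    have hjT : j ∈ T := hT (Finset.mem_insert_self _ _)
    have hΛT : Λ ⊆ T := fun k hk => hT (Finset.mem_insert_of_mem hk)
    rcases Λ.eq_empty_or_nonempty with rfl | hne
    · refine ⟨fun ξ hξ => ?_, fun i hi hi' => ?_⟩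
      · rw [insert_empty_eq, G.sing]; exact G.pos j hjT ξ hξ
      · obtain ⟨a, b, ha, hb, h⟩ := G.bd j hjT i (by simpa using hi')
        refine ⟨a, b, ha, hb, fun ξ hξ => ?_⟩
        have := h ξ hξ
        rw [freeF_single] at this
        simpa [qf, rat, G.sing] using this
    · obtain ⟨hp, hq⟩ := ih hne hΛT
      obtain ⟨a, b, ha, hb, h⟩ := hq j hjT hj
      refine ⟨fun ξ hξ => ?_, fun i hi hi' => ?_⟩
      · have := G.ins hΛT hp hjT hj hξ
        have h2 := (h ξ (hξ.mono (Finset.subset_insert _ _))).2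
        have h3 : (0 : ℝ≥0∞) < ρF (insert j Λ) ξ := by
          rw [this]
          apply ENNReal.div_pos
          · exact_mod_cast (G.pos j hjT ξ (hξ.mono (by simp))).ne'
          · exact (h2.trans_lt hb).ne
        exact_mod_cast h3
      · have hij : i ≠ j := by rintro rfl; simp at hi'
        obtain ⟨a', b', ha', hb', h'⟩ := G.bd j hjT i hij
        refine ⟨a * a', b * b', ENNReal.mul_pos ha.ne' ha'.ne', ENNReal.mul_lt_top hb hb', ?_⟩
        intro ξ hξ
        have key : ∀ s, (ρ i (Function.update ξ i s) : ℝ≥0∞)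
            / (ρF (insert j Λ) (Function.update ξ i s) : ℝ≥0∞)
            = qf lam ρ ρF Λ j (Function.update ξ i s) * rat ρ i j (Function.update ξ i s) := by
          intro s
          have hz := hξ.update hi hi' s
          rw [G.ins hΛT hp hjT hj hz, rat]
          have hr : (ρ j (Function.update ξ i s) : ℝ≥0∞) ≠ 0 := by
            exact_mod_cast (G.pos j hjT _ (hz.mono (by simp))).ne'
          rw [div_eq_mul_inv, ENNReal.inv_div (Or.inr ENNReal.coe_ne_top) (Or.inr hr),
            div_eq_mul_inv, div_eq_mul_inv]
          ring
        have hsm : ∀ s, Zc T ω Λ (Function.update ξ i s) := fun s =>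
          (hξ.update hi hi' s).mono (Finset.subset_insert _ _)
        have hb2 := h' ξ (hξ.mono (by simp))
        rw [freeF_single] at hb2
        unfold qf
        simp_rw [key]
        constructor
        · calc a * a' ≤ a * ∫⁻ s, rat ρ i j (Function.update ξ i s) ∂(lam i) := by
                gcongr; exact hb2.1
            _ ≤ ∫⁻ s, a * rat ρ i j (Function.update ξ i s) ∂(lam i) :=
                lintegral_const_mul_le _ _
            _ ≤ _ := by
                apply lintegral_mono; intro s; dsimp only; gcongr; exact (h _ (hsm s)).1
        · calc _ ≤ ∫⁻ s, b * rat ρ i j (Function.update ξ i s) ∂(lam i) := by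
                apply lintegral_mono; intro s; dsimp only; gcongr; exact (h _ (hsm s)).2
            _ = b * ∫⁻ s, rat ρ i j (Function.update ξ i s) ∂(lam i) :=
                lintegral_const_mul' _ _ hb.ne
            _ ≤ b * b' := by gcongr; exact hb2.2

theorem GoodAt.f1' (G : GoodAt lam ρ ρF T ω) (Λ : Finset ι) (Γ : Finset ι) :
    Disjoint Λ Γ → Λ ∪ Γ ⊆ T → ∀ η, Zc T ω ∅ η →
    (ρF (Λ ∪ Γ) η : ℝ≥0∞) * ρF Λ (Λ.piecewise ω η) = ρF Λ η * ρF (Λ ∪ Γ) (Λ.piecewise ω η) := by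
  induction Γ using Finset.induction_on with
  | empty => intro _ _ η _; simp
  | insert i Γ hi ih =>
    intro hd hT η hη
    rw [Finset.disjoint_insert_right] at hd
    rw [Finset.union_insert] at hT ⊢
    have hiT := hT (Finset.mem_insert_self _ _)
    have hT' : Λ ∪ Γ ⊆ T := fun k hk => hT (Finset.mem_insert_of_mem hk)
    have hi' : i ∉ Λ ∪ Γ := by simp [hi, hd.1]
    rw [G.rc _ hT' i hiT hi' η hη, G.rc _ hT' i hiT hi' _ (hη.pw.mono (by simp))]
    have e : (Λ ∪ Γ).piecewise ω (Λ.piecewise ω η) = (Λ ∪ Γ).piecewise ω η := by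
      ext k
      by_cases h1 : k ∈ Λ <;> by_cases h2 : k ∈ Γ <;> simp [Finset.piecewise, h1, h2]
    rw [e]
    simp only [div_eq_mul_inv]
    rw [mul_right_comm, ih hd.2 hT' η hη, mul_assoc]

theorem GoodAt.f1 (G : GoodAt lam ρ ρF T ω) {Λ : Finset ι} (hT : Λ ⊆ T) {η : Config ι E}
    (hη : Zc T ω ∅ η) :
    (ρF T η : ℝ≥0∞) * ρF Λ (Λ.piecewise ω η) = ρF Λ η * ρF T (Λ.piecewise ω η) := by
  have := G.f1' Λ (T \ Λ) Finset.disjoint_sdiff (Finset.union_sdiff_of_subset hT).subset η hη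
  rwa [Finset.union_sdiff_of_subset hT] at this

/-- `D_Λ`. -/
noncomputable def Df (ρF : Finset ι → Config ι E → ℝ≥0) (T : Finset ι) (ω : Config ι E)
    (Λ : Finset ι) (η : Config ι E) : ℝ≥0∞ :=
  (ρF T (Λ.piecewise ω η) : ℝ≥0∞) / ρF Λ (Λ.piecewise ω η)

theorem GoodAt.f2 (G : GoodAt lam ρ ρF T ω) {Λ : Finset ι} (hne : Λ.Nonempty) (hT : Λ ⊆ T)
    {i : ι} (hi : i ∈ T) (hi' : i ∉ Λ) {η : Config ι E} (hη : Zc T ω ∅ η) :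
    Df ρF T ω (insert i Λ) η = freeF lam {i} (Df ρF T ω Λ) η := by
  obtain ⟨hp, hq⟩ := G.bounds Λ hne hT
  set ξ := (insert i Λ).piecewise ω η with hξd
  have hξ : Zc T ω (insert i Λ) ξ := hη.pw
  have hri : (ρ i ξ : ℝ≥0∞) ≠ 0 := by
    exact_mod_cast (G.pos i hi ξ (hξ.mono (by simp))).ne'
  have e1 : ∀ s, Λ.piecewise ω (Function.update η i s) = Function.update ξ i s := by
    intro s
    ext k
    by_cases hk : k = i
    · subst hk; simp [hi']
    · by_cases hk' : k ∈ Λ <;> simp [hξd, Finset.piecewise, hk, hk']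
  have e2 : ∀ s, ({i} : Finset ι).piecewise ω (Function.update ξ i s) = ξ := by
    intro s
    ext k
    by_cases hk : k = i
    · subst hk; simp [hξ.2 k (by simp)]
    · simp [Finset.piecewise, hk]
  have e3 : ∀ s, Df ρF T ω Λ (Function.update η i s) = ((ρF T ξ : ℝ≥0∞) / ρ i ξ) *
      ((ρ i (Function.update ξ i s) : ℝ≥0∞) / ρF Λ (Function.update ξ i s)) := by
    intro s
    have h := G.f1 (Λ := {i}) (by simpa using hi)
      ((hξ.mono (Finset.empty_subset _)).update hi (by simp) s)
    rw [e2, G.sing] at h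
    have h' : (ρF T (Function.update ξ i s) : ℝ≥0∞)
        = ρ i (Function.update ξ i s) * ρF T ξ / ρ i ξ := by
      rw [ENNReal.eq_div_iff hri ENNReal.coe_ne_top, mul_comm]; exact h
    rw [Df, e1, h']
    simp only [div_eq_mul_inv]
    ring
  rw [freeF_single]
  simp_rw [e3]
  rw [lintegral_const_mul' _ _ (ENNReal.div_ne_top ENNReal.coe_ne_top hri), Df, ← hξd,
    G.ins hT hp hi hi' hξ]
  simp only [div_eq_mul_inv]
  rw [ENNReal.mul_inv (Or.inl hri) (Or.inl ENNReal.coe_ne_top), inv_inv, mul_assoc]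
  simp [qf, div_eq_mul_inv]

/-- Supports. -/
def Sset (ρ : ι → Config ι E → ℝ≥0) (T : Finset ι) (ω : Config ι E) (k : ι) : Set E :=
  {s | k ∈ T ∧ ρ k (Function.update ω k s) ≠ 0}

theorem GoodAt.supp (G : GoodAt lam ρ ρF T ω) {W : Finset ι} (hne : W.Nonempty) (hT : W ⊆ T)
    {k : ι} (hk : k ∈ T) (hk' : k ∉ W) {η : Config ι E} (hη : Zc T ω ∅ η)
    (h : Df ρF T ω W η ≠ 0) : η k ∈ Sset ρ T ω k := by
  refine ⟨hk, fun h0 => h ?_⟩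
  set ζ := W.piecewise ω η with hζ
  have hZ : Zc T ω ∅ ζ := hη.pw.mono (by simp)
  set Λ := T.erase k
  have hΛne : Λ.Nonempty := by
    obtain ⟨w, hw⟩ := hne
    exact ⟨w, Finset.mem_erase.2 ⟨by rintro rfl; exact hk' hw, hT hw⟩⟩
  have hΛT : Λ ⊆ T := Finset.erase_subset _ _
  have h1 := G.f1 hΛT hZ
  have hZ2 : Zc T ω Λ (Λ.piecewise ω ζ) := hZ.pw
  have hpos := (G.bounds Λ hΛne hΛT).1 _ hZ2
  have hu : Λ.piecewise ω ζ = Function.update ω k (η k) := by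
    ext l
    by_cases hl : l = k
    · subst hl; simp [Λ, hζ, hk']
    · by_cases hlT : l ∈ T
      · simp [Λ, Finset.piecewise, hl, hlT]
      · have : l ∉ W := fun h => hlT (hT h)
        simp [Λ, Finset.piecewise, hl, hlT, hζ, this, hη.1 l hlT]
  rw [hu] at hZ2 hpos h1
  have h2 := G.f1 (Λ := {k}) (by simpa using hk) (hZ2.mono (Finset.empty_subset _))
  rw [G.sing, h0] at h2
  have hz3 : 0 < ρ k (({k} : Finset ι).piecewise ω (Function.update ω k (η k))) :=
    G.pos k hk _ (Zc.pw (hZ2.mono (Finset.empty_subset _)))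
  have h3 : (ρF T (Function.update ω k (η k)) : ℝ≥0∞) = 0 := by
    simp only [ENNReal.coe_zero, zero_mul, mul_eq_zero] at h2
    rcases h2 with h2 | h2
    · exact h2
    · exact absurd (by exact_mod_cast h2) hz3.ne'
  rw [h3, mul_zero, mul_eq_zero] at h1
  rw [Df, ← hζ]
  rcases h1 with h1 | h1
  · rw [h1]; simp
  · exact absurd (by exact_mod_cast h1) hpos.ne'

theorem GoodAt.measS (G : GoodAt lam ρ ρF T ω) (k : ι) : MeasurableSet (Sset ρ T ω k) := by
  have hm : Measurable fun s => ρ k (Function.update ω k s) := by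
    rw [← G.sing]
    exact (G.meas {k}).comp (measurable_update ω)
  exact (MeasurableSet.const _).inter (hm (measurableSet_singleton 0).compl)

theorem GoodAt.sf (G : GoodAt lam ρ ρF T ω) (h2 : ∀ k ∈ T, ∃ j ∈ T, k ≠ j) (k : ι) :
    SigmaFinite ((lam k).restrict (Sset ρ T ω k)) := by
  by_cases hk : k ∈ T
  · obtain ⟨j, hj, hkj⟩ := h2 k hk
    obtain ⟨a, b, -, hb, h⟩ := G.bd j hj k hkj
    have hω : Zc T ω {j} ω := ⟨fun _ _ => rfl, fun _ _ => rfl⟩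
    have hle := (h ω hω).2
    rw [freeF_single] at hle
    have hmr : ∀ i, Measurable (ρ i) := fun i => by rw [← G.sing]; exact G.meas _
    have hS : Sset ρ T ω k = {s | rat ρ k j (Function.update ω k s) ≠ 0} := by
      ext s
      simp [Sset, rat, hk]
    rw [hS]
    refine sf_restrict _ _ ?_ (hle.trans_lt hb).ne
    unfold rat
    exact ((hmr k).comp (measurable_update ω)).coe_nnreal_ennreal.div
      ((hmr j).comp (measurable_update ω)).coe_nnreal_ennreal
  · have : Sset ρ T ω k = ∅ := by ext s; simp [Sset, hk]
    rw [this, Measure.restrict_empty]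
    infer_instance

theorem GoodAt.measD (G : GoodAt lam ρ ρF T ω) (W : Finset ι) : Measurable (Df ρF T ω W) := by
  have hm : Measurable fun η : Config ι E => W.piecewise ω η := by
    rw [measurable_pi_iff]
    intro k
    by_cases hk : k ∈ W
    · simp [hk]
    · simp only [hk, not_false_eq_true, Finset.piecewise_eq_of_notMem]; exact measurable_pi_apply k
  exact ((G.meas T).comp hm).coe_nnreal_ennreal.div ((G.meas W).comp hm).coe_nnreal_ennreal

theorem GoodAt.f3 (G : GoodAt lam ρ ρF T ω) (h2 : ∀ k ∈ T, ∃ j ∈ T, k ≠ j) {W : Finset ι}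
    (hne : W.Nonempty) (V : Finset ι) : Disjoint V W → V ∪ W ⊆ T → ∀ η, Zc T ω ∅ η →
    Df ρF T ω (V ∪ W) η
      = freeF (fun k => (lam k).restrict (Sset ρ T ω k)) V (Df ρF T ω W) η := by
  have hsf := G.sf h2
  induction V using Finset.induction_on with
  | empty => intro _ _ η _; rw [freeF_eq, lmarginal_empty, Finset.empty_union]
  | insert i V hi ih =>
    intro hd hT η hη
    rw [Finset.disjoint_insert_left] at hd
    rw [Finset.insert_union] at hT ⊢
    have hiT := hT (Finset.mem_insert_self _ _)
    have hT' : V ∪ W ⊆ T := fun k hk => hT (Finset.mem_insert_of_mem hk)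
    have hi' : i ∉ V ∪ W := by simp [hi, hd.1]
    have hne' : (V ∪ W).Nonempty := hne.mono Finset.subset_union_right
    rw [G.f2 hne' hT' hiT hi' hη,
      freeF_restrict lam (Sset ρ T ω) G.measS hsf, freeF_single, freeF_eq,
      lmarginal_insert _ (G.measD W) hi]
    · refine lintegral_congr fun s => ?_
      rw [ih hd.2 hT' _ (hη.update hiT (by simp) s), freeF_eq]
    · rintro σ hσ ⟨k, hk⟩
      obtain rfl : k = i := by simpa using hk
      have hz : Zc T ω ∅ (subst {k} σ η) := by
        refine ⟨fun l hl => ?_, by simp⟩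
        have : l ≠ k := by rintro rfl; exact hl hiT
        simp [subst, this, hη.1 l hl]
      have := G.supp hne' hT' hiT hi' hz hσ
      simpa [subst] using this

theorem GoodAt.final (G : GoodAt lam ρ ρF T ω) {V W : Finset ι} (hV : V.Nonempty)
    (hW : W.Nonempty) (hd : Disjoint V W) (hT : V ∪ W = T) :
    (ρF T ω : ℝ≥0∞) = (ρF V ω : ℝ≥0∞) /
        freeF lam V (fun η => (ρF V η : ℝ≥0∞) / (ρF W η : ℝ≥0∞)) ω := by
  have hVT : V ⊆ T := hT ▸ Finset.subset_union_left
  have hWT : W ⊆ T := hT ▸ Finset.subset_union_right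
  have h2 : ∀ k ∈ T, ∃ j ∈ T, k ≠ j := by
    obtain ⟨v, hv⟩ := hV
    obtain ⟨w, hw⟩ := hW
    have hvw : v ≠ w := by rintro rfl; exact Finset.disjoint_left.1 hd hv hw
    intro k _
    by_cases hk : k = v
    · exact ⟨w, hWT hw, hk ▸ hvw⟩
    · exact ⟨v, hVT hv, hk⟩
  have hω : ∀ Λ, Zc T ω Λ ω := fun _ => ⟨fun _ _ => rfl, fun _ _ => rfl⟩
  have hTne : T.Nonempty := hV.mono hVT
  have hz : ∀ σ, Zc T ω ∅ (subst V σ ω) := by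
    intro σ
    refine ⟨fun l hl => ?_, by simp⟩
    have : l ∉ V := fun h => hl (hVT h)
    simp [subst, this]
  have h3 := G.f3 h2 hW V hd hT.subset ω (hω _)
  rw [← freeF_restrict lam (Sset ρ T ω) G.measS (G.sf h2)] at h3
  swap
  · rintro σ hσ ⟨k, hk⟩
    have := G.supp hW hWT (hVT hk) (fun h => Finset.disjoint_left.1 hd hk h) (hz σ) hσ
    simpa [subst, hk] using this
  have hTpos := (G.bounds T hTne subset_rfl).1 ω (hω _)
  have hVpos := (G.bounds V hV hVT).1 ω (hω _)
  have hT0 : (ρF T ω : ℝ≥0∞) ≠ 0 := by exact_mod_cast hTpos.ne'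
  have hV0 : (ρF V ω : ℝ≥0∞) ≠ 0 := by exact_mod_cast hVpos.ne'
  rw [hT, Df, (hω T).pw_eq, ENNReal.div_self hT0 ENNReal.coe_ne_top] at h3
  have key : ∀ σ, Df ρF T ω W (subst V σ ω) = ((ρF T ω : ℝ≥0∞) / ρF V ω) *
      ((ρF V (subst V σ ω) : ℝ≥0∞) / ρF W (subst V σ ω)) := by
    intro σ
    have hW' : Zc T ω W (subst V σ ω) := by
      refine ⟨(hz σ).1, fun k hk => ?_⟩
      have : k ∉ V := fun h => Finset.disjoint_left.1 hd h hk
      simp [subst, this]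
    have hpw : V.piecewise ω (subst V σ ω) = ω := by
      ext k
      by_cases hk : k ∈ V <;> simp [hk, subst]
    have h := G.f1 hVT (hz σ)
    rw [hpw] at h
    have h' : (ρF T (subst V σ ω) : ℝ≥0∞) = ρF V (subst V σ ω) * ρF T ω / ρF V ω := by
      rw [ENNReal.eq_div_iff hV0 ENNReal.coe_ne_top, mul_comm]; exact h
    rw [Df, hW'.pw_eq, h']
    simp only [div_eq_mul_inv]
    ring
  have h4 : freeF lam V (Df ρF T ω W) ω = ((ρF T ω : ℝ≥0∞) / ρF V ω) *
      freeF lam V (fun η => (ρF V η : ℝ≥0∞) / (ρF W η : ℝ≥0∞)) ω := by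
    unfold freeF
    simp_rw [key]
    rw [lintegral_const_mul' _ _ (ENNReal.div_ne_top ENNReal.coe_ne_top hV0)]
  rw [h4] at h3
  set I := freeF lam V (fun η => (ρF V η : ℝ≥0∞) / (ρF W η : ℝ≥0∞)) ω
  have hI : I = ((ρF T ω : ℝ≥0∞) / ρF V ω)⁻¹ := by
    rw [mul_comm] at h3
    exact ENNReal.eq_inv_of_mul_eq_one_left h3.symm
  rw [hI, div_eq_mul_inv, inv_inv, ENNReal.mul_div_cancel hV0 ENNReal.coe_ne_top]

theorem goodAt_of (hrec : IsRec lam ρ ρF)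
    (hω : ∀ i ∈ T, ω ∈ BSet lam ρ i (T.erase i)) : GoodAt lam ρ ρF T ω := by
  obtain ⟨-, hs, hm, hr⟩ := hrec
  have rep : ∀ j ∈ T, ∀ η, Zc T ω {j} η →
      η = subst (T.erase j) (fun k => η k.1) (Function.update ω j (ω j)) := by
    intro j hj η hη
    ext k
    by_cases hk : k = j
    · subst hk; simp [subst, hη.2 k (by simp)]
    · by_cases hkT : k ∈ T
      · simp [subst, hk, hkT]
      · simp [subst, hk, hkT, hη.1 k hkT]
  have pos : ∀ j ∈ T, ∀ η, Zc T ω {j} η → 0 < ρ j η := by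
    intro j hj η hη
    rw [rep j hj η hη]
    exact (hω j hj).1 _
  have bd : ∀ j ∈ T, ∀ i, i ≠ j → ∃ a b : ℝ≥0∞, 0 < a ∧ b < ⊤ ∧ ∀ η, Zc T ω {j} η →
    a ≤ freeF lam {i} (rat ρ i j) η ∧ freeF lam {i} (rat ρ i j) η ≤ b := by
    intro j hj i hij
    obtain ⟨h1, h2⟩ := (hω j hj).2 i hij
    refine ⟨_, _, h1, h2, fun η hη => ?_⟩
    rw [rep j hj η hη]
    exact ⟨iInf_le (fun σ => freeF lam {i} (rat ρ i j)
        (subst (T.erase j) σ (Function.update ω j (ω j)))) _,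
      le_iSup (fun σ => freeF lam {i} (rat ρ i j)
        (subst (T.erase j) σ (Function.update ω j (ω j)))) _⟩
  refine ⟨pos, bd, hs, hm, fun Λ hΛ i hi hi' η hη => ?_⟩
  have hmem : (fun k : {x // x ∈ Λ} => ω k.1) ∈ bSetF lam ρ Λ {i} η := by
    rintro ⟨k, hk⟩
    have hki : k ≠ i := by rintro rfl; exact hi' hk
    have hz : ∀ σ, Zc T ω {k} (subst (Λ.erase k ∪ {i}) σ (Function.update η k (ω k))) := by
      intro σ
      refine ⟨fun l hl => ?_, fun l hl => ?_⟩
      · have h1 : l ∉ Λ := fun h => hl (hΛ h)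
        have h2 : l ≠ i := by rintro rfl; exact hl hi
        have h3 : l ≠ k := by rintro rfl; exact hl (hΛ hk)
        simp [subst, h1, h2, h3, hη.1 l hl]
      · obtain rfl : l = k := by simpa using hl
        simp [subst, hki]
    refine ⟨fun σ => pos k (hΛ hk) _ (hz σ), fun l hl => ?_⟩
    obtain ⟨a, b, ha, hb, h⟩ := bd k (hΛ hk) l hl
    exact ⟨ha.trans_le (le_iInf fun σ => (h _ (hz σ)).1),
      (iSup_le fun σ => (h _ (hz σ)).2).trans_lt hb⟩
  rw [(hr Λ i hi' η).2 _ hmem, Rexpr, freeF_single, hs]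
  rfl

end core

end GibbsSingleton

open GibbsSingleton MeasureTheory ProbabilityTheory

/-- **Lemma 3 (1).**  For disjoint nonempty finite `V, W`, on the set
`B_{V∪W} = ⋂_{i∈V∪W} B(i,(V∪W)∖{i})` one has
`ρ_{V∪W} = ρ_V / λ_V(ρ_V ρ_W⁻¹) = ρ_W / λ_W(ρ_W ρ_V⁻¹)`. -/
theorem constructed_family_on_good_event
    {d : ℕ} (hd : 0 < d) {E : Type*} [MeasurableSpace E]
    (lam : (Fin d → ℤ) → Measure E)
    (ρ : (Fin d → ℤ) → Config (Fin d → ℤ) E → ℝ≥0)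
    (hmeas : ∀ i, Measurable (ρ i))
    (h1 : H1 lam ρ) (h2 : H2 lam ρ)
    (ρF : Finset (Fin d → ℤ) → Config (Fin d → ℤ) E → ℝ≥0)
    (hrec : IsRec lam ρ ρF)
    (V W : Finset (Fin d → ℤ)) (hV : V.Nonempty) (hW : W.Nonempty) (hdisj : Disjoint V W) :
    ∀ ω ∈ ⋂ i ∈ (V ∪ W : Finset (Fin d → ℤ)), BSet lam ρ i ((V ∪ W).erase i),
      (ρF (V ∪ W) ω : ℝ≥0∞)
          = (ρF V ω : ℝ≥0∞) /
              freeF lam V (fun η => (ρF V η : ℝ≥0∞) / (ρF W η : ℝ≥0∞)) ω ∧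
      (ρF (V ∪ W) ω : ℝ≥0∞)
          = (ρF W ω : ℝ≥0∞) /
              freeF lam W (fun η => (ρF W η : ℝ≥0∞) / (ρF V η : ℝ≥0∞)) ω := by
  intro ω hω
  have G : GoodAt lam ρ ρF (V ∪ W) ω := goodAt_of hrec fun i hi => by
    simp only [Set.mem_iInter] at hω
    exact hω i hi
  exact ⟨G.final hV hW hdisj rfl, G.final hW hV hdisj.symm (Finset.union_comm _ _)⟩
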